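/- Key trace-exponential inequality in the proof of stronger subadditivity: Let ρ₁₂₃ be a positive definite density matrix on H₁⊗H₂⊗H₃ and let K^1,…,K^M be operators on H₁⊗H₂ with ∑_α K^{α*}K^α = id_{H₁⊗H₂}. Set n^α = Tr[(K^α⊗id₃) ρ₁₂₃ (K^{α*}⊗id₃)] and assume n^α > 0 for all α; set ρ₂₃^α = Tr₁[(K^α⊗id₃) ρ₁₂₃ (K^{α*}⊗id₃)]/n^α and ρ₂^α = Tr₃ ρ₂₃^α, and assume ρ₂₃^α and ρ₂^α are positive definite for all α. Then Tr_{H₁⊗H₂⊗H₃} exp( (ln ρ₁₂)⊗id₃ − ∑_α (K^{α*}⊗id₃) ( id₁⊗(ln ρ₂^α)⊗id₃ − id₁⊗(ln ρ₂₃^α) ) (K^α⊗id₃) ) ≤ 1, where ρ₁₂ = Tr₃ ρ₁₂₃ and id₁⊗(ln ρ₂₃^α) denotes ln ρ₂₃^α acting on H₂⊗H₃ extended by the identity on H₁. -/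

import Mathlib

open Matrix Kronecker Real
open scoped ComplexOrder

/-- Von Neumann entropy of a (Hermitian) matrix: the sum of `-λ ln λ` over its
eigenvalues, with the convention `0 ln 0 = 0`. -/
noncomputable def entropy {n : Type*} [Fintype n] [DecidableEq n]
    (A : Matrix n n ℂ) : ℝ :=
  if h : A.IsHermitian then ∑ i, Real.negMulLog (h.eigenvalues i) else 0

/-- Partial trace over the first factor of a twofold tensor product. -/
noncomputable def ptraceFst {m k : Type*} [Fintype m]
    (ρ : Matrix (m × k) (m × k) ℂ) : Matrix k k ℂ :=
  Matrix.of fun i j => ∑ a : m, ρ (a, i) (a, j)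

/-- Partial trace over the second factor of a twofold tensor product. -/
noncomputable def ptraceSnd {m k : Type*} [Fintype k]
    (ρ : Matrix (m × k) (m × k) ℂ) : Matrix m m ℂ :=
  Matrix.of fun i j => ∑ a : k, ρ (i, a) (j, a)

/-- Partial trace over the first factor of a threefold tensor product
(indexed as `(H₁ ⊗ H₂) ⊗ H₃`). -/
noncomputable def ptraceFst₃ {a b c : Type*} [Fintype a]
    (ρ : Matrix ((a × b) × c) ((a × b) × c) ℂ) : Matrix (b × c) (b × c) ℂ :=
  Matrix.of fun p q => ∑ i : a, ρ ((i, p.1), p.2) ((i, q.1), q.2)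

/-- Logarithm of a (Hermitian) matrix, defined via the spectral functional
calculus. -/
noncomputable def matLog {n : Type*} [Fintype n] [DecidableEq n]
    (A : Matrix n n ℂ) : Matrix n n ℂ :=
  if h : A.IsHermitian then
    (h.eigenvectorUnitary : Matrix n n ℂ) *
      Matrix.diagonal (fun i => (Real.log (h.eigenvalues i) : ℂ)) *
      (star h.eigenvectorUnitary : Matrix n n ℂ)
  else 0


/-! ### The matrix logarithm and the continuous functional calculus -/

section MatLog

variable {m n : Type*} [Fintype m] [DecidableEq m] [Fintype n] [DecidableEq n]

theorem matLog_eq_cfc {A : Matrix n n ℂ} (hA : A.IsHermitian) : matLog A = cfc Real.log A := by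
  rw [hA.cfc_eq, matLog, dif_pos hA, Matrix.IsHermitian.cfc, Unitary.conjStarAlgAut_apply]
  rfl

theorem isHermitian_matLog (A : Matrix n n ℂ) : (matLog A).IsHermitian := by
  by_cases hA : A.IsHermitian
  · rw [matLog_eq_cfc hA]
    exact cfc_predicate (p := IsSelfAdjoint) Real.log A
  · simp [matLog, hA]

theorem map_matLog (φ : Matrix m m ℂ →⋆ₐ[ℂ] Matrix n n ℂ) {A : Matrix m m ℂ}
    (hA : A.IsHermitian) : φ (matLog A) = matLog (φ A) := by
  have hA' : IsSelfAdjoint A := hA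
  have hφA : IsSelfAdjoint (φ A) := hA'.map φ
  have hcont : Continuous φ := φ.toAlgHom.toLinearMap.continuous_of_finiteDimensional
  rw [matLog_eq_cfc hA, matLog_eq_cfc hφA]
  exact φ.map_cfc Real.log A (A.finite_real_spectrum.continuousOn _) hcont hA' hφA

theorem exp_eq_cfc {X : Matrix n n ℂ} (hX : X.IsHermitian) :
    NormedSpace.exp X = cfc Real.exp X := by
  have hU : ((hX.eigenvectorUnitary : Matrix n n ℂ))⁻¹ = star (hX.eigenvectorUnitary : Matrix n n ℂ) :=
    Matrix.inv_eq_left_inv (by simp)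
  have h := Matrix.exp_conj (hX.eigenvectorUnitary : Matrix n n ℂ)
    (diagonal (RCLike.ofReal ∘ hX.eigenvalues)) (Unitary.toUnits hX.eigenvectorUnitary).isUnit
  rw [hU, Matrix.exp_diagonal] at h
  rw [hX.cfc_eq, Matrix.IsHermitian.cfc, Unitary.conjStarAlgAut_apply]
  conv_lhs => rw [hX.spectral_theorem, Unitary.conjStarAlgAut_apply]
  refine h.trans ?_
  congr 3
  ext i
  simp [Pi.coe_exp, Complex.exp_eq_exp_ℂ]

theorem posDef_exp {X : Matrix n n ℂ} (hX : X.IsHermitian) : (NormedSpace.exp X).PosDef := by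
  have hX2 : ((1 / 2 : ℂ) • X).IsHermitian := by
    rw [Matrix.IsHermitian, conjTranspose_smul, hX.eq]; simp
  have h : NormedSpace.exp X = (NormedSpace.exp ((1 / 2 : ℂ) • X))ᴴ * NormedSpace.exp ((1 / 2 : ℂ) • X) := by
    rw [hX2.exp.eq, ← Matrix.exp_add_of_commute _ _ (Commute.refl _), ← add_smul]
    norm_num
  rw [h]
  exact Matrix.PosDef.conjTranspose_mul_self _
    (Matrix.mulVec_injective_of_isUnit (Matrix.isUnit_exp _))

theorem matLog_exp {X : Matrix n n ℂ} (hX : X.IsHermitian) : matLog (NormedSpace.exp X) = X := by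
  rw [matLog_eq_cfc (posDef_exp hX).isHermitian, exp_eq_cfc hX]
  refine (cfc_comp Real.log Real.exp X hX ((X.finite_real_spectrum.image _).continuousOn _)
      (X.finite_real_spectrum.continuousOn _)).symm.trans ?_
  simp only [Function.comp_def, Real.log_exp]
  exact cfc_id' ℝ X hX

end MatLog

/-! ### Relative entropy of positive definite matrices -/

section RelEntropy

variable {n : Type*} [Fintype n] [DecidableEq n]

/-- Umegaki relative entropy `Tr ρ (ln ρ - ln σ)`. -/
noncomputable def relEntropy (ρ σ : Matrix n n ℂ) : ℝ :=
  (ρ * (matLog ρ - matLog σ)).trace.re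

/-- Squared overlaps `|⟨w_j, u_i⟩|²` of the eigenbases of `σ` and `ρ`. -/
noncomputable def overlap {ρ σ : Matrix n n ℂ} (hρ : ρ.IsHermitian) (hσ : σ.IsHermitian)
    (j i : n) : ℝ :=
  Complex.normSq
    ((star (hσ.eigenvectorUnitary : Matrix n n ℂ) * (hρ.eigenvectorUnitary : Matrix n n ℂ)) j i)

theorem overlap_nonneg {ρ σ : Matrix n n ℂ} (hρ : ρ.IsHermitian) (hσ : σ.IsHermitian) (j i : n) :
    0 ≤ overlap hρ hσ j i :=
  Complex.normSq_nonneg _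

theorem sum_overlap {ρ σ : Matrix n n ℂ} (hρ : ρ.IsHermitian) (hσ : σ.IsHermitian) (i : n) :
    ∑ j, overlap hρ hσ j i = 1 := by
  set C := star (hσ.eigenvectorUnitary : Matrix n n ℂ) * (hρ.eigenvectorUnitary : Matrix n n ℂ)
    with hC
  have h : star C * C = 1 := by
    rw [hC, star_mul, star_star, mul_assoc, ← mul_assoc (hσ.eigenvectorUnitary : Matrix n n ℂ)]
    simp
  have h2 := congrFun (congrFun h i) i
  rw [Matrix.mul_apply, Matrix.one_apply_eq] at h2
  have h3 := congrArg Complex.re h2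
  rw [Complex.re_sum, Complex.one_re] at h3
  rw [← h3]
  refine Finset.sum_congr rfl fun j _ => ?_
  rw [overlap, Complex.normSq_apply, Matrix.star_apply]
  simp [hC]

theorem trace_conj_diagonal_mul (U W : Matrix n n ℂ) (p s : n → ℝ) :
    ((U * diagonal (fun i => (p i : ℂ)) * star U) *
      (W * diagonal (fun i => (s i : ℂ)) * star W)).trace.re =
    ∑ i, ∑ j, Complex.normSq ((star W * U) j i) * (p i * s j) := by
  have h : ((U * diagonal (fun i => (p i : ℂ)) * star U) *
      (W * diagonal (fun i => (s i : ℂ)) * star W)).trace =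
      ((star W * U) * diagonal (fun i => (p i : ℂ)) * star (star W * U) *
        diagonal (fun i => (s i : ℂ))).trace := by
    rw [star_mul, star_star, ← mul_assoc, Matrix.trace_mul_comm]
    simp only [mul_assoc]
  rw [h, Matrix.trace, Complex.re_sum, Finset.sum_comm]
  refine Finset.sum_congr rfl fun j _ => ?_
  rw [Matrix.diag_apply, Matrix.mul_diagonal, Matrix.mul_apply, Finset.sum_mul, Complex.re_sum]
  refine Finset.sum_congr rfl fun i _ => ?_
  rw [Matrix.mul_diagonal, Matrix.star_apply, Complex.normSq_apply]
  simp
  ring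

theorem eq_conj_diagonal {ρ : Matrix n n ℂ} (hρ : ρ.IsHermitian) :
    ρ = (hρ.eigenvectorUnitary : Matrix n n ℂ) * diagonal (fun i => (hρ.eigenvalues i : ℂ)) *
      star (hρ.eigenvectorUnitary : Matrix n n ℂ) := by
  conv_lhs => rw [hρ.spectral_theorem, Unitary.conjStarAlgAut_apply]
  rfl

theorem matLog_eq_conj_diagonal {ρ : Matrix n n ℂ} (hρ : ρ.IsHermitian) :
    matLog ρ = (hρ.eigenvectorUnitary : Matrix n n ℂ) *
      diagonal (fun i => (Real.log (hρ.eigenvalues i) : ℂ)) *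
      star (hρ.eigenvectorUnitary : Matrix n n ℂ) := by
  rw [matLog, dif_pos hρ]

theorem re_trace_eq_sum_overlap {ρ σ : Matrix n n ℂ} (hρ : ρ.IsHermitian) (hσ : σ.IsHermitian) :
    ρ.trace.re = ∑ i, ∑ j, overlap hρ hσ j i * hρ.eigenvalues i := by
  simp_rw [← Finset.sum_mul, sum_overlap, one_mul]
  rw [hρ.trace_eq_sum_eigenvalues, Complex.re_sum]
  rfl

theorem relEntropy_eq_sum_overlap {ρ σ : Matrix n n ℂ} (hρ : ρ.IsHermitian) (hσ : σ.IsHermitian) :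
    relEntropy ρ σ = ∑ i, ∑ j, overlap hρ hσ j i *
      (hρ.eigenvalues i * (Real.log (hρ.eigenvalues i) - Real.log (hσ.eigenvalues j))) := by
  have h1 : (ρ * matLog σ).trace.re = ∑ i, ∑ j, overlap hρ hσ j i *
      (hρ.eigenvalues i * Real.log (hσ.eigenvalues j)) := by
    rw [matLog_eq_conj_diagonal hσ]
    conv_lhs => rw [eq_conj_diagonal hρ]
    exact trace_conj_diagonal_mul _ _ _ _
  have h2 : (ρ * matLog ρ).trace.re = ∑ i, ∑ j, overlap hρ hσ j i *
      (hρ.eigenvalues i * Real.log (hρ.eigenvalues i)) := by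
    simp_rw [← Finset.sum_mul, sum_overlap, one_mul]
    rw [matLog_eq_conj_diagonal hρ]
    conv_lhs => enter [1, 1, 1]; rw [eq_conj_diagonal hρ]
    have : ∀ U D E : Matrix n n ℂ, star U * U = 1 →
        (U * D * star U * (U * E * star U)).trace = (D * E).trace := fun U D E hU => by
      rw [show U * D * star U * (U * E * star U) = U * (D * (star U * U) * E * star U) by
        simp only [mul_assoc], hU, Matrix.trace_mul_comm, mul_one, mul_assoc, hU, mul_one]
    rw [this _ _ _ (by simp), diagonal_mul_diagonal, trace_diagonal, Complex.re_sum]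
    simp [← Complex.ofReal_mul]
  rw [relEntropy, mul_sub, trace_sub, Complex.sub_re, h1, h2, ← Finset.sum_sub_distrib]
  refine Finset.sum_congr rfl fun i _ => ?_
  rw [← Finset.sum_sub_distrib]
  exact Finset.sum_congr rfl fun j _ => by ring

theorem overlap_comm {ρ σ : Matrix n n ℂ} (hρ : ρ.IsHermitian) (hσ : σ.IsHermitian) (j i : n) :
    overlap hρ hσ j i = overlap hσ hρ i j := by
  have h : star (hρ.eigenvectorUnitary : Matrix n n ℂ) * (hσ.eigenvectorUnitary : Matrix n n ℂ) =
      star (star (hσ.eigenvectorUnitary : Matrix n n ℂ) *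
        (hρ.eigenvectorUnitary : Matrix n n ℂ)) := by
    rw [star_mul, star_star]
  rw [overlap, overlap, h, Matrix.star_apply, Complex.star_def, Complex.normSq_conj]

theorem sub_le_mul_log_sub_log {p s : ℝ} (hp : 0 < p) (hs : 0 < s) :
    p - s ≤ p * (Real.log p - Real.log s) := by
  have h := Real.one_sub_inv_le_log_of_pos (div_pos hp hs)
  rw [Real.log_div hp.ne' hs.ne', inv_div] at h
  have h2 := mul_le_mul_of_nonneg_left h hp.le
  rwa [mul_sub, mul_one, mul_div_cancel₀ _ hp.ne'] at h2

/-- Klein's inequality. -/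
theorem trace_sub_trace_le_relEntropy {ρ σ : Matrix n n ℂ} (hρ : ρ.PosDef) (hσ : σ.PosDef) :
    ρ.trace.re - σ.trace.re ≤ relEntropy ρ σ := by
  have hσtr : σ.trace.re = ∑ i, ∑ j, overlap hρ.isHermitian hσ.isHermitian j i *
      hσ.isHermitian.eigenvalues j := by
    rw [re_trace_eq_sum_overlap hσ.isHermitian hρ.isHermitian, Finset.sum_comm]
    simp only [overlap_comm hσ.isHermitian hρ.isHermitian]
  rw [hσtr, re_trace_eq_sum_overlap hρ.isHermitian hσ.isHermitian,
    relEntropy_eq_sum_overlap hρ.isHermitian hσ.isHermitian, ← Finset.sum_sub_distrib]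
  refine Finset.sum_le_sum fun i _ => ?_
  rw [← Finset.sum_sub_distrib]
  refine Finset.sum_le_sum fun j _ => ?_
  rw [← mul_sub]
  exact mul_le_mul_of_nonneg_left
    (sub_le_mul_log_sub_log (hρ.eigenvalues_pos i) (hσ.eigenvalues_pos j)) (overlap_nonneg _ _ j i)

/-- The quadratic form `⟨ρ, (L_σ + t R_ρ)⁻¹ ρ⟩` in the Hilbert–Schmidt inner product, where `L_σ`
and `R_ρ` are left and right multiplication. -/
noncomputable def resolventForm {ρ σ : Matrix n n ℂ} (hρ : ρ.IsHermitian) (hσ : σ.IsHermitian)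
    (t : ℝ) : ℝ :=
  ∑ i, ∑ j, overlap hρ hσ j i *
    (hρ.eigenvalues i ^ 2 / (hσ.eigenvalues j + t * hρ.eigenvalues i))

/-- The concave quadratic functional whose maximum over `Y` is `resolventForm`. -/
noncomputable def resolventFunctional (ρ σ : Matrix n n ℂ) (t : ℝ) (Y : Matrix n n ℂ) : ℝ :=
  2 * (ρ * Yᴴ).trace.re - (σ * (Y * Yᴴ)).trace.re - t * (ρ * (Yᴴ * Y)).trace.re

theorem resolventFunctional_conj {ρ σ : Matrix n n ℂ} (hρ : ρ.IsHermitian) (hσ : σ.IsHermitian)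
    (t : ℝ) (y : Matrix n n ℂ) :
    resolventFunctional ρ σ t
      ((hσ.eigenvectorUnitary : Matrix n n ℂ) * y *
        star (hρ.eigenvectorUnitary : Matrix n n ℂ)) =
    ∑ i, ∑ j, (2 * hρ.eigenvalues i * (star (y j i) *
      ((star (hσ.eigenvectorUnitary : Matrix n n ℂ) *
        (hρ.eigenvectorUnitary : Matrix n n ℂ)) j i)).re
      - (hσ.eigenvalues j + t * hρ.eigenvalues i) * Complex.normSq (y j i)) := by
  have hU : star (hρ.eigenvectorUnitary : Matrix n n ℂ) * hρ.eigenvectorUnitary = 1 := by simp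
  have hW : star (hσ.eigenvectorUnitary : Matrix n n ℂ) * hσ.eigenvectorUnitary = 1 := by simp
  rw [resolventFunctional]
  have eρ := eq_conj_diagonal hρ
  have eσ := eq_conj_diagonal hσ
  generalize (hρ.eigenvectorUnitary : Matrix n n ℂ) = U at *
  generalize (hσ.eigenvectorUnitary : Matrix n n ℂ) = W at *
  generalize hρ.eigenvalues = p at *
  generalize hσ.eigenvalues = s at *
  rw [eρ, eσ]
  have hUa : ∀ Z, star U * (U * Z) = Z := fun Z => by rw [← mul_assoc, hU, one_mul]
  have hWa : ∀ Z, star W * (W * Z) = Z := fun Z => by rw [← mul_assoc, hW, one_mul]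
  have hY : (W * y * star U)ᴴ = U * yᴴ * star W := by
    simp [← star_eq_conjTranspose, mul_assoc]
  have h1 : (U * diagonal (fun i => (p i : ℂ)) * star U * (U * yᴴ * star W)).trace =
      (diagonal (fun i => (p i : ℂ)) * (yᴴ * (star W * U))).trace := by
    rw [mul_assoc, mul_assoc, Matrix.trace_mul_comm]
    simp only [mul_assoc, hUa]
  have h2 : (W * diagonal (fun i => (s i : ℂ)) * star W *
      (W * y * star U * (U * yᴴ * star W))).trace =
      (diagonal (fun i => (s i : ℂ)) * (y * yᴴ)).trace := by
    rw [mul_assoc, mul_assoc, Matrix.trace_mul_comm]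
    simp only [mul_assoc, hUa, hWa, hW, mul_one]
  have h3 : (U * diagonal (fun i => (p i : ℂ)) * star U *
      (U * yᴴ * star W * (W * y * star U))).trace =
      (diagonal (fun i => (p i : ℂ)) * (yᴴ * y)).trace := by
    rw [mul_assoc, mul_assoc, Matrix.trace_mul_comm]
    simp only [mul_assoc, hUa, hWa, hU, mul_one]
  rw [hY, h1, h2, h3]
  have e1 : (diagonal (fun i => (p i : ℂ)) * (yᴴ * (star W * U))).trace.re =
      ∑ i, ∑ j, p i * (star (y j i) * (star W * U) j i).re := by
    rw [Matrix.trace, Complex.re_sum]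
    refine Finset.sum_congr rfl fun i _ => ?_
    rw [Matrix.diag_apply, Matrix.diagonal_mul, Matrix.mul_apply, Complex.re_ofReal_mul,
      Complex.re_sum, Finset.mul_sum]
    simp only [conjTranspose_apply]
  have e2 : (diagonal (fun i => (s i : ℂ)) * (y * yᴴ)).trace.re =
      ∑ i, ∑ j, s j * Complex.normSq (y j i) := by
    rw [Matrix.trace, Complex.re_sum, Finset.sum_comm]
    refine Finset.sum_congr rfl fun i _ => ?_
    rw [Matrix.diag_apply, Matrix.diagonal_mul, Matrix.mul_apply, Complex.re_ofReal_mul,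
      Complex.re_sum, Finset.mul_sum]
    refine Finset.sum_congr rfl fun j _ => ?_
    simp [Complex.normSq_apply]
  have e3 : (diagonal (fun i => (p i : ℂ)) * (yᴴ * y)).trace.re =
      ∑ i, ∑ j, p i * Complex.normSq (y j i) := by
    rw [Matrix.trace, Complex.re_sum]
    refine Finset.sum_congr rfl fun i _ => ?_
    rw [Matrix.diag_apply, Matrix.diagonal_mul, Matrix.mul_apply, Complex.re_ofReal_mul,
      Complex.re_sum, Finset.mul_sum]
    refine Finset.sum_congr rfl fun j _ => ?_
    simp [Complex.normSq_apply]
  rw [e1, e2, e3]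
  simp only [Finset.mul_sum, ← Finset.sum_sub_distrib]
  exact Finset.sum_congr rfl fun i _ => Finset.sum_congr rfl fun j _ => by ring

theorem resolventFunctional_le {ρ σ : Matrix n n ℂ} (hρ : ρ.PosDef) (hσ : σ.PosDef)
    {t : ℝ} (ht : 0 ≤ t) (Y : Matrix n n ℂ) :
    resolventFunctional ρ σ t Y ≤ resolventForm hρ.isHermitian hσ.isHermitian t := by
  set U := (hρ.isHermitian.eigenvectorUnitary : Matrix n n ℂ) with hUdef
  set W := (hσ.isHermitian.eigenvectorUnitary : Matrix n n ℂ) with hWdef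
  have hY : Y = W * (star W * Y * U) * star U := by
    have hU : U * star U = 1 := by simp [hUdef]
    have hW : W * star W = 1 := by simp [hWdef]
    simp only [← mul_assoc, hW, one_mul]
    rw [mul_assoc, hU, mul_one]
  rw [hY, resolventFunctional_conj, resolventForm]
  refine Finset.sum_le_sum fun i _ => Finset.sum_le_sum fun j _ => ?_
  rw [overlap]
  have hp := hρ.eigenvalues_pos i
  have hs := hσ.eigenvalues_pos j
  generalize (star W * Y * U) j i = z
  generalize (star W * U) j i = c
  generalize hρ.isHermitian.eigenvalues i = p at *
  generalize hσ.isHermitian.eigenvalues j = s at *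
  have hd : 0 < s + t * p := by positivity
  generalize s + t * p = d at *
  rw [← mul_div_assoc, le_div_iff₀ hd]
  simp only [Complex.normSq_apply, Complex.mul_re, Complex.star_def, Complex.conj_re,
    Complex.conj_im]
  nlinarith [sq_nonneg (d * z.re - p * c.re), sq_nonneg (d * z.im - p * c.im)]

theorem exists_resolventFunctional_eq {ρ σ : Matrix n n ℂ} (hρ : ρ.PosDef) (hσ : σ.PosDef)
    {t : ℝ} (ht : 0 ≤ t) :
    ∃ Y, resolventFunctional ρ σ t Y = resolventForm hρ.isHermitian hσ.isHermitian t := by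
  set U := (hρ.isHermitian.eigenvectorUnitary : Matrix n n ℂ) with hUdef
  set W := (hσ.isHermitian.eigenvectorUnitary : Matrix n n ℂ) with hWdef
  refine ⟨W * Matrix.of (fun j i => ((hρ.isHermitian.eigenvalues i / (hσ.isHermitian.eigenvalues j +
    t * hρ.isHermitian.eigenvalues i) : ℝ) : ℂ) * (star W * U) j i) * star U, ?_⟩
  rw [resolventFunctional_conj, resolventForm]
  refine Finset.sum_congr rfl fun i _ => Finset.sum_congr rfl fun j _ => ?_
  rw [overlap, Matrix.of_apply]
  have hp := hρ.eigenvalues_pos i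
  have hs := hσ.eigenvalues_pos j
  generalize (star W * U) j i = c
  generalize hρ.isHermitian.eigenvalues i = p at *
  generalize hσ.isHermitian.eigenvalues j = s at *
  have hd : 0 < s + t * p := by positivity
  generalize s + t * p = d at *
  rw [map_mul, Complex.normSq_ofReal, star_mul', Complex.star_def, Complex.conj_ofReal,
    mul_assoc ((p / d : ℝ) : ℂ),
    Complex.re_ofReal_mul, ← Complex.normSq_eq_conj_mul_self, Complex.ofReal_re]
  field_simp
  ring

end RelEntropy

section TruncRelEntropy

open Filter Topology

variable {n : Type*} [Fintype n] [DecidableEq n]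

/-- The integral of `resolventForm` over `[0, t]`. -/
noncomputable def truncRelEntropy {ρ σ : Matrix n n ℂ} (hρ : ρ.IsHermitian) (hσ : σ.IsHermitian)
    (t : ℝ) : ℝ :=
  ∑ i, ∑ j, overlap hρ hσ j i * (hρ.eigenvalues i *
    (Real.log (hσ.eigenvalues j + t * hρ.eigenvalues i) - Real.log (hσ.eigenvalues j)))

theorem truncRelEntropy_zero {ρ σ : Matrix n n ℂ} (hρ : ρ.IsHermitian) (hσ : σ.IsHermitian) :
    truncRelEntropy hρ hσ 0 = 0 := by
  simp [truncRelEntropy]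

theorem hasDerivAt_truncRelEntropy {ρ σ : Matrix n n ℂ} (hρ : ρ.PosDef) (hσ : σ.PosDef)
    {t : ℝ} (ht : 0 ≤ t) :
    HasDerivAt (truncRelEntropy hρ.isHermitian hσ.isHermitian)
      (resolventForm hρ.isHermitian hσ.isHermitian t) t := by
  unfold truncRelEntropy resolventForm
  refine HasDerivAt.fun_sum fun i _ => HasDerivAt.fun_sum fun j _ => HasDerivAt.const_mul _ ?_
  have hp := hρ.eigenvalues_pos i
  have hs := hσ.eigenvalues_pos j
  have hd : hσ.isHermitian.eigenvalues j + t * hρ.isHermitian.eigenvalues i ≠ 0 := by positivity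
  have h := (((((hasDerivAt_id' t).mul_const (hρ.isHermitian.eigenvalues i)).const_add
    (hσ.isHermitian.eigenvalues j)).log hd).sub_const
      (Real.log (hσ.isHermitian.eigenvalues j))).const_mul (hρ.isHermitian.eigenvalues i)
  convert h using 1
  ring

theorem tendsto_truncRelEntropy {ρ σ : Matrix n n ℂ} (hρ : ρ.PosDef) (hσ : σ.PosDef) :
    Tendsto (fun t => truncRelEntropy hρ.isHermitian hσ.isHermitian t - ρ.trace.re * Real.log t)
      atTop (𝓝 (relEntropy ρ σ)) := by
  rw [relEntropy_eq_sum_overlap hρ.isHermitian hσ.isHermitian]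
  have h : ∀ᶠ t : ℝ in atTop, ∑ i, ∑ j, overlap hρ.isHermitian hσ.isHermitian j i *
      (hρ.isHermitian.eigenvalues i * (Real.log (hσ.isHermitian.eigenvalues j / t +
        hρ.isHermitian.eigenvalues i) - Real.log (hσ.isHermitian.eigenvalues j))) =
      truncRelEntropy hρ.isHermitian hσ.isHermitian t - ρ.trace.re * Real.log t := by
    filter_upwards [eventually_gt_atTop 0] with t ht
    rw [re_trace_eq_sum_overlap hρ.isHermitian hσ.isHermitian, truncRelEntropy, Finset.sum_mul,
      ← Finset.sum_sub_distrib]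
    refine Finset.sum_congr rfl fun i _ => ?_
    rw [Finset.sum_mul, ← Finset.sum_sub_distrib]
    refine Finset.sum_congr rfl fun j _ => ?_
    have hp := hρ.eigenvalues_pos i
    have hs := hσ.eigenvalues_pos j
    rw [show hσ.isHermitian.eigenvalues j + t * hρ.isHermitian.eigenvalues i =
      t * (hσ.isHermitian.eigenvalues j / t + hρ.isHermitian.eigenvalues i) by field_simp,
      Real.log_mul ht.ne' (by positivity)]
    ring
  refine Tendsto.congr' h ?_
  refine tendsto_finsetSum _ fun i _ => tendsto_finsetSum _ fun j _ =>
    Tendsto.const_mul _ (Tendsto.const_mul _ (Tendsto.sub_const ?_ _))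
  have hp := hρ.eigenvalues_pos i
  have h0 : Tendsto (fun t : ℝ => hσ.isHermitian.eigenvalues j / t +
      hρ.isHermitian.eigenvalues i) atTop (𝓝 (0 + hρ.isHermitian.eigenvalues i)) :=
    (tendsto_const_nhds.div_atTop tendsto_id).add_const _
  rw [zero_add] at h0
  exact h0.log hp.ne'

end TruncRelEntropy

/-! ### Monotonicity of relative entropy under quantum instruments -/

section Monotonicity

open Filter Topology

variable {ι m n : Type*} [Fintype m] [DecidableEq m] [Fintype n] [DecidableEq n]

theorem re_trace_mul_conjTranspose_mul_self_nonneg {k : Type*} [Fintype k] {ρ : Matrix k k ℂ}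
    (hρ : ρ.PosSemidef) (G : Matrix k k ℂ) : 0 ≤ (ρ * (Gᴴ * G)).trace.re := by
  rw [← mul_assoc, Matrix.trace_mul_comm, ← mul_assoc]
  exact (RCLike.nonneg_iff.mp (hρ.mul_mul_conjTranspose_same G).trace_nonneg).1

/-- Kadison–Schwarz inequality for a unital map in Stinespring form, tested against `ρ ≥ 0`. -/
theorem re_trace_mul_kadison_schwarz [Fintype ι] (φ : Matrix m m ℂ →⋆ₐ[ℂ] Matrix n n ℂ)
    {κ : ι → Matrix n n ℂ} (hκ : ∑ a, (κ a)ᴴ * κ a = 1) {ρ : Matrix n n ℂ} (hρ : ρ.PosSemidef)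
    (Z : ι → Matrix m m ℂ) :
    (ρ * ((∑ a, (κ a)ᴴ * φ (Z a) * κ a)ᴴ * ∑ a, (κ a)ᴴ * φ (Z a) * κ a)).trace.re ≤
      ∑ a, (ρ * ((κ a)ᴴ * φ ((Z a)ᴴ * Z a) * κ a)).trace.re := by
  set B := ∑ a, (κ a)ᴴ * φ (Z a) * κ a with hB
  have hφ : ∀ Y, φ Yᴴ = (φ Y)ᴴ := fun Y => map_star φ Y
  have hBH : Bᴴ = ∑ a, (κ a)ᴴ * (φ (Z a))ᴴ * κ a := by
    rw [hB, conjTranspose_sum]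
    simp [conjTranspose_mul, mul_assoc]
  have key : ∑ a, (φ (Z a) * κ a - κ a * B)ᴴ * (φ (Z a) * κ a - κ a * B) =
      ∑ a, (κ a)ᴴ * φ ((Z a)ᴴ * Z a) * κ a - Bᴴ * B := by
    have h1 : ∀ a, (φ (Z a) * κ a - κ a * B)ᴴ * (φ (Z a) * κ a - κ a * B) =
        (κ a)ᴴ * φ ((Z a)ᴴ * Z a) * κ a - ((κ a)ᴴ * (φ (Z a))ᴴ * κ a) * B
          - Bᴴ * ((κ a)ᴴ * φ (Z a) * κ a) + Bᴴ * ((κ a)ᴴ * κ a) * B := fun a => by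
      rw [conjTranspose_sub, conjTranspose_mul, conjTranspose_mul, map_mul, hφ]
      noncomm_ring
    simp_rw [h1]
    rw [Finset.sum_add_distrib, Finset.sum_sub_distrib, Finset.sum_sub_distrib, ← Finset.sum_mul,
      ← Finset.sum_mul, ← Finset.mul_sum, ← Finset.mul_sum, ← hBH, ← hB, hκ]
    noncomm_ring
  have h0 : 0 ≤ ∑ a, (ρ * ((φ (Z a) * κ a - κ a * B)ᴴ *
      (φ (Z a) * κ a - κ a * B))).trace.re :=
    Finset.sum_nonneg fun a _ => re_trace_mul_conjTranspose_mul_self_nonneg hρ _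
  rw [← Complex.re_sum, ← trace_sum, ← Finset.mul_sum, key, mul_sub, trace_sub, Complex.sub_re,
    Finset.mul_sum, trace_sum, Complex.re_sum] at h0
  linarith

theorem sum_resolventFunctional_le [Fintype ι] (φ : Matrix m m ℂ →⋆ₐ[ℂ] Matrix n n ℂ)
    {κ : ι → Matrix n n ℂ} (hκ : ∑ a, (κ a)ᴴ * κ a = 1) {ρ σ : Matrix n n ℂ}
    (hρ : ρ.PosSemidef) (hσ : σ.PosSemidef) {ρ' σ' : ι → Matrix m m ℂ}
    (hρρ' : ∀ a Y, (ρ' a * Y).trace = (ρ * ((κ a)ᴴ * φ Y * κ a)).trace)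
    (hσσ' : ∀ a Y, (σ' a * Y).trace = (σ * ((κ a)ᴴ * φ Y * κ a)).trace)
    {t : ℝ} (ht : 0 ≤ t) (Y : ι → Matrix m m ℂ) :
    ∑ a, resolventFunctional (ρ' a) (σ' a) t (Y a) ≤
      resolventFunctional ρ σ t (∑ a, (κ a)ᴴ * φ (Y a) * κ a) := by
  have hφ : ∀ Y, φ Yᴴ = (φ Y)ᴴ := fun Y => map_star φ Y
  have hBH : (∑ a, (κ a)ᴴ * φ (Y a) * κ a)ᴴ = ∑ a, (κ a)ᴴ * φ (Y a)ᴴ * κ a := by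
    rw [conjTranspose_sum]
    simp [conjTranspose_mul, mul_assoc, hφ]
  have h1 := re_trace_mul_kadison_schwarz φ hκ hρ Y
  have h2 := re_trace_mul_kadison_schwarz φ hκ hσ (fun a => (Y a)ᴴ)
  rw [← hBH, conjTranspose_conjTranspose] at h2
  simp only [conjTranspose_conjTranspose] at h2
  simp only [resolventFunctional, hρρ', hσσ', Finset.sum_sub_distrib, ← Finset.mul_sum]
  have h3 : ∑ a, (ρ * ((κ a)ᴴ * φ (Y a)ᴴ * κ a)).trace.re =
      (ρ * (∑ a, (κ a)ᴴ * φ (Y a) * κ a)ᴴ).trace.re := by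
    rw [hBH, Finset.mul_sum, trace_sum, Complex.re_sum]
  rw [h3]
  nlinarith

/-- Relative entropy does not increase under the completely positive instrument
`ρ ↦ (ρ' a)ₐ` dual to `Y ↦ (κ a)ᴴ φ(Y) κ a`. -/
theorem sum_relEntropy_le [Fintype ι] (φ : Matrix m m ℂ →⋆ₐ[ℂ] Matrix n n ℂ)
    {κ : ι → Matrix n n ℂ} (hκ : ∑ a, (κ a)ᴴ * κ a = 1) {ρ σ : Matrix n n ℂ}
    (hρ : ρ.PosDef) (hσ : σ.PosDef) {ρ' σ' : ι → Matrix m m ℂ}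
    (hρ' : ∀ a, (ρ' a).PosDef) (hσ' : ∀ a, (σ' a).PosDef)
    (hρρ' : ∀ a Y, (ρ' a * Y).trace = (ρ * ((κ a)ᴴ * φ Y * κ a)).trace)
    (hσσ' : ∀ a Y, (σ' a * Y).trace = (σ * ((κ a)ᴴ * φ Y * κ a)).trace) :
    ∑ a, relEntropy (ρ' a) (σ' a) ≤ relEntropy ρ σ := by
  have hres : ∀ t : ℝ, 0 ≤ t →
      ∑ a, resolventForm (hρ' a).isHermitian (hσ' a).isHermitian t ≤
        resolventForm hρ.isHermitian hσ.isHermitian t := fun t ht => by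
    choose Y hY using fun a => exists_resolventFunctional_eq (hρ' a) (hσ' a) ht
    simp_rw [← hY]
    exact (sum_resolventFunctional_le φ hκ hρ.posSemidef hσ.posSemidef hρρ' hσσ' ht Y).trans
      (resolventFunctional_le hρ hσ ht _)
  have hderiv : ∀ t : ℝ, 0 ≤ t → HasDerivAt
      (fun t => truncRelEntropy hρ.isHermitian hσ.isHermitian t -
        ∑ a, truncRelEntropy (hρ' a).isHermitian (hσ' a).isHermitian t)
      (resolventForm hρ.isHermitian hσ.isHermitian t -
        ∑ a, resolventForm (hρ' a).isHermitian (hσ' a).isHermitian t) t := fun t ht =>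
    (hasDerivAt_truncRelEntropy hρ hσ ht).sub
      (HasDerivAt.fun_sum fun a _ => hasDerivAt_truncRelEntropy (hρ' a) (hσ' a) ht)
  have hmono : MonotoneOn (fun t => truncRelEntropy hρ.isHermitian hσ.isHermitian t -
      ∑ a, truncRelEntropy (hρ' a).isHermitian (hσ' a).isHermitian t) (Set.Ici 0) := by
    refine monotoneOn_of_deriv_nonneg (convex_Ici 0)
      (fun t ht => (hderiv t ht).continuousAt.continuousWithinAt) ?_ ?_
    all_goals rw [interior_Ici]; intro t ht
    · exact (hderiv t (Set.mem_Ioi.mp ht).le).differentiableAt.differentiableWithinAt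
    · rw [(hderiv t (Set.mem_Ioi.mp ht).le).deriv]
      exact sub_nonneg.mpr (hres t (Set.mem_Ioi.mp ht).le)
  have htr : ρ.trace.re = ∑ a, (ρ' a).trace.re := by
    have h : ∀ a, (ρ' a).trace = (ρ * ((κ a)ᴴ * κ a)).trace := fun a => by
      simpa using hρρ' a 1
    simp_rw [h]
    rw [← Complex.re_sum, ← trace_sum, ← Finset.mul_sum, hκ, mul_one]
  have hlim := tendsto_finsetSum Finset.univ
    (fun a _ => tendsto_truncRelEntropy (hρ' a) (hσ' a))
  refine le_of_tendsto_of_tendsto hlim (tendsto_truncRelEntropy hρ hσ) ?_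
  filter_upwards [eventually_ge_atTop 0] with t ht
  have h := hmono Set.self_mem_Ici (Set.mem_Ici.mpr ht) ht
  simp only [truncRelEntropy_zero, Finset.sum_const_zero, sub_zero] at h
  rw [Finset.sum_sub_distrib, ← Finset.sum_mul, ← htr]
  linarith

theorem relEntropy_le (φ : Matrix m m ℂ →⋆ₐ[ℂ] Matrix n n ℂ) {ρ σ : Matrix n n ℂ}
    (hρ : ρ.PosDef) (hσ : σ.PosDef) {ρ' σ' : Matrix m m ℂ} (hρ' : ρ'.PosDef) (hσ' : σ'.PosDef)
    (hρρ' : ∀ Y, (ρ' * Y).trace = (ρ * φ Y).trace)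
    (hσσ' : ∀ Y, (σ' * Y).trace = (σ * φ Y).trace) :
    relEntropy ρ' σ' ≤ relEntropy ρ σ := by
  simpa using sum_relEntropy_le (ι := Unit) φ (κ := fun _ => 1) (by simp) hρ hσ
    (fun _ => hρ') (fun _ => hσ') (by simpa using hρρ') (by simpa using hσσ')

/-- If the image of some matrix under the completely positive map dual to `Y ↦ κᴴ φ(Y) κ` is
positive definite, then so is the image of every positive definite matrix. -/
theorem posDef_of_trace_mul_eq (φ : Matrix m m ℂ →⋆ₐ[ℂ] Matrix n n ℂ) (κ : Matrix n n ℂ)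
    {ρ τ : Matrix n n ℂ} {ρ' τ' : Matrix m m ℂ} (hρ' : ρ'.PosDef) (hτ : τ.PosDef)
    (hρρ' : ∀ Y, (ρ' * Y).trace = (ρ * (κᴴ * φ Y * κ)).trace)
    (hττ' : ∀ Y, (τ' * Y).trace = (τ * (κᴴ * φ Y * κ)).trace) : τ'.PosDef := by
  have hφ : ∀ Y, φ Yᴴ = (φ Y)ᴴ := fun Y => map_star φ Y
  refine PosDef.of_dotProduct_mulVec_pos ?_ fun x hx => ?_
  · refine Matrix.ext_iff_trace_mul_right.mpr fun Y => ?_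
    have h : (τ'ᴴ * Y).trace = star (τ' * Yᴴ).trace := by
      rw [← trace_conjTranspose, conjTranspose_mul, conjTranspose_conjTranspose,
        Matrix.trace_mul_comm]
    rw [h, hττ', hττ', ← trace_conjTranspose, conjTranspose_mul, Matrix.trace_mul_comm,
      hτ.isHermitian.eq, hφ]
    simp [conjTranspose_mul, mul_assoc]
  · set Y := vecMulVec x (star x) with hY
    have htr : ∀ A : Matrix m m ℂ, star x ⬝ᵥ (A *ᵥ x) = (A * Y).trace := fun A => by
      rw [hY, mul_vecMulVec, trace_vecMulVec, dotProduct_comm]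
    have hc : 0 < star x ⬝ᵥ x := dotProduct_star_self_pos_iff.mpr hx
    have hYY : Yᴴ * Y = (star x ⬝ᵥ x) • Y := by
      rw [hY, conjTranspose_vecMulVec, star_star, vecMulVec_mul_vecMulVec]
      simp [vecMulVec_smul]
    set F := φ Y * κ with hF
    have hFF : Fᴴ * F = (star x ⬝ᵥ x) • (κᴴ * φ Y * κ) := by
      rw [hF, conjTranspose_mul, ← hφ, mul_assoc, ← mul_assoc (φ Yᴴ), ← map_mul, hYY, map_smul]
      simp [mul_assoc]
    have hF0 : F ≠ 0 := fun h0 => by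
      rw [h0, mul_zero] at hFF
      have h1 : κᴴ * φ Y * κ = 0 := (smul_eq_zero.mp hFF.symm).resolve_left hc.ne'
      have h2 := hρ'.dotProduct_mulVec_pos hx
      rw [htr, hρρ', h1, mul_zero, trace_zero] at h2
      exact lt_irrefl _ h2
    have hpos : 0 < (F * τ * Fᴴ).trace := by
      have hps := hτ.posSemidef.mul_mul_conjTranspose_same F
      refine lt_of_le_of_ne hps.trace_nonneg fun h0 => hF0 ?_
      have hz := hps.trace_eq_zero_iff.mp h0.symm
      have hker : ∀ v, Fᴴ *ᵥ v = 0 := fun v => by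
        by_contra hv
        have := hτ.dotProduct_mulVec_pos hv
        rw [star_mulVec, conjTranspose_conjTranspose, ← dotProduct_mulVec, mulVec_mulVec,
          mulVec_mulVec, hz] at this
        simp at this
      have : Fᴴ = 0 := Matrix.ext_of_mulVec_single fun i => by rw [hker, zero_mulVec]
      simpa using this
    have heq : (F * τ * Fᴴ).trace = (star x ⬝ᵥ x) * (τ' * Y).trace := by
      rw [mul_assoc, Matrix.trace_mul_comm, mul_assoc, hFF, hττ']
      simp
    rw [htr]
    rw [heq] at hpos
    exact (mul_pos_iff_of_pos_left hc).mp hpos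

end Monotonicity

/-! ### Partial traces -/

section PartialTrace

variable {a b c : Type*} [Fintype a] [DecidableEq a] [Fintype b] [DecidableEq b]
  [Fintype c] [DecidableEq c]

/-- `Y ↦ Y ⊗ 1`. -/
noncomputable def kroneckerOneHom (a b : Type*) [Fintype a] [DecidableEq a] [Fintype b]
    [DecidableEq b] : Matrix a a ℂ →⋆ₐ[ℂ] Matrix (a × b) (a × b) ℂ where
  toFun Y := Y ⊗ₖ (1 : Matrix b b ℂ)
  map_one' := one_kronecker_one
  map_mul' X Y := by rw [← mul_kronecker_mul, mul_one]
  map_zero' := zero_kronecker _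
  map_add' X Y := add_kronecker X Y _
  commutes' r := by
    rw [Algebra.algebraMap_eq_smul_one, Algebra.algebraMap_eq_smul_one, smul_kronecker,
      one_kronecker_one]
  map_star' X := by simp [star_eq_conjTranspose, conjTranspose_kronecker]

/-- `Y ↦ 1 ⊗ Y`, regarded as acting on `(H₁ ⊗ H₂) ⊗ H₃`. -/
noncomputable def oneKroneckerHom (a b c : Type*) [Fintype a] [DecidableEq a] [Fintype b]
    [DecidableEq b] [Fintype c] [DecidableEq c] :
    Matrix (b × c) (b × c) ℂ →⋆ₐ[ℂ] Matrix ((a × b) × c) ((a × b) × c) ℂ where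
  toFun Y := Matrix.reindex (Equiv.prodAssoc a b c).symm (Equiv.prodAssoc a b c).symm
    ((1 : Matrix a a ℂ) ⊗ₖ Y)
  map_one' := by simp
  map_mul' X Y := by
    simp only [reindex_apply]
    rw [submatrix_mul_equiv, ← mul_kronecker_mul, mul_one]
  map_zero' := by simp
  map_add' X Y := by
    rw [kronecker_add]
    rfl
  commutes' r := by
    rw [Algebra.algebraMap_eq_smul_one, Algebra.algebraMap_eq_smul_one, kronecker_smul,
      one_kronecker_one, reindex_apply, submatrix_smul, Pi.smul_apply, Pi.smul_apply,
      submatrix_one_equiv]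
  map_star' X := by simp [star_eq_conjTranspose, conjTranspose_kronecker]

theorem kroneckerOneHom_apply (Y : Matrix a a ℂ) :
    kroneckerOneHom a b Y = Y ⊗ₖ (1 : Matrix b b ℂ) := rfl

theorem oneKroneckerHom_apply (Y : Matrix (b × c) (b × c) ℂ) :
    oneKroneckerHom a b c Y = Matrix.reindex (Equiv.prodAssoc a b c).symm
      (Equiv.prodAssoc a b c).symm ((1 : Matrix a a ℂ) ⊗ₖ Y) := rfl

theorem oneKroneckerHom_kroneckerOneHom (Y : Matrix b b ℂ) :
    oneKroneckerHom a b c (kroneckerOneHom b c Y) =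
      ((1 : Matrix a a ℂ) ⊗ₖ Y) ⊗ₖ (1 : Matrix c c ℂ) := by
  rw [kroneckerOneHom_apply, oneKroneckerHom_apply, ← kronecker_assoc, reindex_apply,
    reindex_apply, submatrix_submatrix]
  ext i j
  simp

theorem trace_ptraceSnd_mul (A : Matrix (a × b) (a × b) ℂ) (Y : Matrix a a ℂ) :
    (ptraceSnd A * Y).trace = (A * kroneckerOneHom a b Y).trace := by
  simp only [kroneckerOneHom_apply, Matrix.trace, Matrix.diag_apply, Matrix.mul_apply, ptraceSnd,
    Matrix.of_apply, Fintype.sum_prod_type, kroneckerMap_apply, Matrix.one_apply, mul_ite, mul_one,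
    mul_zero, Finset.sum_ite_eq', Finset.mem_univ, if_true, Finset.sum_mul]
  exact Finset.sum_congr rfl fun i _ => Finset.sum_comm

theorem trace_ptraceFst₃_mul (A : Matrix ((a × b) × c) ((a × b) × c) ℂ)
    (Y : Matrix (b × c) (b × c) ℂ) :
    (ptraceFst₃ A * Y).trace = (A * oneKroneckerHom a b c Y).trace := by
  have h : ∀ i : a, ∀ p : b × c, ∑ q : (a × b) × c, A ((i, p.1), p.2) q *
      oneKroneckerHom a b c Y q ((i, p.1), p.2) =
      ∑ q : b × c, A ((i, p.1), p.2) ((i, q.1), q.2) * Y q p := fun i p => by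
    simp [oneKroneckerHom_apply, Fintype.sum_prod_type, Matrix.one_apply, Finset.sum_ite_irrel]
  calc (ptraceFst₃ A * Y).trace
      = ∑ p : b × c, ∑ i : a, ∑ q : b × c, A ((i, p.1), p.2) ((i, q.1), q.2) * Y q p := by
        simp only [Matrix.trace, Matrix.diag_apply, Matrix.mul_apply, ptraceFst₃, Matrix.of_apply,
          Finset.sum_mul]
        exact Finset.sum_congr rfl fun p _ => Finset.sum_comm
    _ = (A * oneKroneckerHom a b c Y).trace := by
        simp_rw [← h]
        simp only [Matrix.trace, Matrix.diag_apply, Matrix.mul_apply]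
        rw [Finset.sum_comm, ← Fintype.sum_prod_type',
          ← (Equiv.prodAssoc a b c).symm.sum_comp]
        rfl

theorem trace_ptraceSnd (A : Matrix (a × b) (a × b) ℂ) : (ptraceSnd A).trace = A.trace := by
  simpa using trace_ptraceSnd_mul A 1

theorem ptraceSnd_conj (K : Matrix a a ℂ) (A : Matrix (a × b) (a × b) ℂ) :
    ptraceSnd (kroneckerOneHom a b K * A * (kroneckerOneHom a b K)ᴴ) =
      K * ptraceSnd A * Kᴴ := by
  refine Matrix.ext_iff_trace_mul_right.mpr fun Y => ?_
  have h : (K * ptraceSnd A * Kᴴ * Y).trace = (ptraceSnd A * (Kᴴ * Y * K)).trace := by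
    simp only [mul_assoc]
    rw [Matrix.trace_mul_comm]
    simp only [mul_assoc]
  rw [h, trace_ptraceSnd_mul, trace_ptraceSnd_mul, map_mul, map_mul, ← star_eq_conjTranspose K,
    map_star, ← star_eq_conjTranspose]
  simp only [mul_assoc]
  rw [Matrix.trace_mul_comm]
  simp only [mul_assoc]

theorem ptraceSnd_ptraceFst₃ {a b c : Type*} [Fintype a] [Fintype c]
    (A : Matrix ((a × b) × c) ((a × b) × c) ℂ) :
    ptraceSnd (ptraceFst₃ A) = ptraceFst (ptraceSnd A) := by
  ext i j
  exact Finset.sum_comm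

theorem ptraceFst₃_kroneckerOneHom (A : Matrix (a × b) (a × b) ℂ) :
    ptraceFst₃ (kroneckerOneHom (a × b) c A) = kroneckerOneHom b c (ptraceFst A) := by
  ext i j
  simp [ptraceFst₃, ptraceFst, kroneckerOneHom_apply, Finset.sum_mul]

theorem kroneckerOneHom_ptraceSnd_ptraceFst₃_conj (K : Matrix (a × b) (a × b) ℂ)
    (A : Matrix ((a × b) × c) ((a × b) × c) ℂ) :
    kroneckerOneHom b c (ptraceSnd (ptraceFst₃
      (kroneckerOneHom (a × b) c K * A * (kroneckerOneHom (a × b) c K)ᴴ))) =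
    ptraceFst₃ (kroneckerOneHom (a × b) c K * kroneckerOneHom (a × b) c (ptraceSnd A) *
      (kroneckerOneHom (a × b) c K)ᴴ) := by
  rw [ptraceSnd_ptraceFst₃, ptraceSnd_conj, ← ptraceFst₃_kroneckerOneHom, map_mul, map_mul,
    ← star_eq_conjTranspose K, map_star, ← star_eq_conjTranspose]

theorem trace_ptraceFst₃_conj_mul (κ A : Matrix ((a × b) × c) ((a × b) × c) ℂ)
    (Y : Matrix (b × c) (b × c) ℂ) :
    (ptraceFst₃ (κ * A * κᴴ) * Y).trace = (A * (κᴴ * oneKroneckerHom a b c Y * κ)).trace := by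
  rw [trace_ptraceFst₃_mul]
  simp only [mul_assoc]
  rw [Matrix.trace_mul_comm]
  simp only [mul_assoc]

theorem posDef_kroneckerOneHom {A : Matrix a a ℂ} (hA : A.PosDef) :
    (kroneckerOneHom a b A).PosDef :=
  hA.kronecker PosDef.one

theorem posDef_ptraceSnd [Nonempty b] {A : Matrix (a × b) (a × b) ℂ} (hA : A.PosDef) :
    (ptraceSnd A).PosDef := by
  have hcard : (0 : ℂ) < Fintype.card b := by exact_mod_cast Fintype.card_pos
  refine posDef_of_trace_mul_eq (kroneckerOneHom a b) 1 (ρ := 1)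
    (ρ' := (Fintype.card b : ℂ) • (1 : Matrix a a ℂ)) (PosDef.one.smul hcard) hA
    (fun Y => ?_) (fun Y => by simpa using trace_ptraceSnd_mul A Y)
  simp [kroneckerOneHom_apply, trace_kronecker, mul_comm]

end PartialTrace

/-- **Key trace-exponential inequality** in the proof of stronger
subadditivity:
`Tr exp( ln ρ₁₂ ⊗ 1₃ − ∑_α K^{α*} ( 1₁ ⊗ ln ρ₂^α ⊗ 1₃ − 1₁ ⊗ ln ρ₂₃^α ) K^α ) ≤ 1`. -/
theorem trace_exp_le_one
    {n₁ n₂ n₃ : Type*} [Fintype n₁] [Fintype n₂] [Fintype n₃]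
    [DecidableEq n₁] [DecidableEq n₂] [DecidableEq n₃] {M : ℕ}
    (ρ : Matrix ((n₁ × n₂) × n₃) ((n₁ × n₂) × n₃) ℂ)
    (hρ : ρ.PosDef) (hρtr : ρ.trace = 1)
    (K : Fin M → Matrix (n₁ × n₂) (n₁ × n₂) ℂ)
    (hK : ∑ α, (K α)ᴴ * K α = 1)
    (n : Fin M → ℝ)
    (hn : ∀ α, n α =
      (((K α ⊗ₖ (1 : Matrix n₃ n₃ ℂ)) * ρ *
        ((K α)ᴴ ⊗ₖ (1 : Matrix n₃ n₃ ℂ))).trace).re)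
    (hnpos : ∀ α, 0 < n α)
    (ρ23 : Fin M → Matrix (n₂ × n₃) (n₂ × n₃) ℂ)
    (hρ23 : ∀ α, ρ23 α = ((n α : ℂ))⁻¹ •
      ptraceFst₃ ((K α ⊗ₖ (1 : Matrix n₃ n₃ ℂ)) * ρ *
        ((K α)ᴴ ⊗ₖ (1 : Matrix n₃ n₃ ℂ))))
    (ρ2 : Fin M → Matrix n₂ n₂ ℂ)
    (hρ2 : ∀ α, ρ2 α = ptraceSnd (ρ23 α))
    (hρ23pos : ∀ α, (ρ23 α).PosDef) (hρ2pos : ∀ α, (ρ2 α).PosDef) :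
    ((NormedSpace.exp
        (matLog (ptraceSnd ρ) ⊗ₖ (1 : Matrix n₃ n₃ ℂ)
          - ∑ α, ((K α)ᴴ ⊗ₖ (1 : Matrix n₃ n₃ ℂ)) *
              ( ((1 : Matrix n₁ n₁ ℂ) ⊗ₖ matLog (ρ2 α)) ⊗ₖ (1 : Matrix n₃ n₃ ℂ)
                - Matrix.reindex (Equiv.prodAssoc n₁ n₂ n₃).symm
                    (Equiv.prodAssoc n₁ n₂ n₃).symm
                    ((1 : Matrix n₁ n₁ ℂ) ⊗ₖ matLog (ρ23 α)) ) *
              (K α ⊗ₖ (1 : Matrix n₃ n₃ ℂ)))).trace).re ≤ 1 := by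
  set χ := kroneckerOneHom (n₁ × n₂) n₃ with hχ
  set ψ := kroneckerOneHom n₂ n₃ with hψ
  set φ := oneKroneckerHom n₁ n₂ n₃ with hφ
  have hne : Nonempty n₃ := by
    by_contra h
    rw [not_nonempty_iff] at h
    rw [Matrix.trace_eq_zero_of_isEmpty] at hρtr
    exact zero_ne_one hρtr
  have hKH : ∀ α, (K α)ᴴ ⊗ₖ (1 : Matrix n₃ n₃ ℂ) = (χ (K α))ᴴ := fun α =>
    map_star χ (K α)
  have hKχ : ∀ α, K α ⊗ₖ (1 : Matrix n₃ n₃ ℂ) = χ (K α) := fun α => rfl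
  have hκ : ∑ α, (χ (K α))ᴴ * χ (K α) = 1 := by
    have h : ∀ α, (χ (K α))ᴴ * χ (K α) = χ ((K α)ᴴ * K α) := fun α => by
      rw [map_mul, ← hKH]; rfl
    simp_rw [h]
    rw [← map_sum, hK, map_one]
  simp only [hKH, hKχ] at hρ23
  have hφψ : ∀ Y : Matrix n₂ n₂ ℂ, ((1 : Matrix n₁ n₁ ℂ) ⊗ₖ Y) ⊗ₖ (1 : Matrix n₃ n₃ ℂ) =
      φ (ψ Y) := fun Y => (oneKroneckerHom_kroneckerOneHom Y).symm
  simp only [hφψ, hKH, ← kroneckerOneHom_apply, ← oneKroneckerHom_apply, ← hχ, ← hφ]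
  set X := χ (matLog (ptraceSnd ρ)) - ∑ α, (χ (K α))ᴴ *
    (φ (ψ (matLog (ρ2 α))) - φ (matLog (ρ23 α))) * χ (K α) with hXdef
  have hX : X.IsHermitian := by
    refine IsSelfAdjoint.sub ((isHermitian_matLog _).isSelfAdjoint.map χ)
      (isSelfAdjoint_sum _ fun α _ => ?_)
    exact isHermitian_conjTranspose_mul_mul _
      ((((isHermitian_matLog _).isSelfAdjoint.map ψ).map φ).sub
        ((isHermitian_matLog _).isSelfAdjoint.map φ))
  set T := NormedSpace.exp X with hTdef
  have hT : T.PosDef := posDef_exp hX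
  have hlogT : matLog T = X := matLog_exp hX
  set T23 := fun α => ptraceFst₃ (χ (K α) * T * (χ (K α))ᴴ) with hT23def
  have hT23Y : ∀ α Y, (T23 α * Y).trace = (T * ((χ (K α))ᴴ * φ Y * χ (K α))).trace :=
    fun α Y => trace_ptraceFst₃_conj_mul _ _ _
  have hT23 : ∀ α, (T23 α).PosDef := fun α =>
    posDef_of_trace_mul_eq φ (χ (K α)) (ρ := ((n α : ℂ))⁻¹ • ρ) (hρ23pos α) hT (fun Y => by
      rw [hρ23, smul_mul_assoc, smul_mul_assoc, trace_smul, trace_smul,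
        trace_ptraceFst₃_conj_mul]) (hT23Y α)
  have hT2 : ∀ α, (ptraceSnd (T23 α)).PosDef := fun α => posDef_ptraceSnd (hT23 α)
  have hT12 : (ptraceSnd T).PosDef := posDef_ptraceSnd hT
  have hρ12 : (ptraceSnd ρ).PosDef := posDef_ptraceSnd hρ
  have hpartial : ∀ α, relEntropy (ptraceSnd (T23 α)) (ρ2 α) ≤ relEntropy (T23 α) (ρ23 α) :=
    fun α => relEntropy_le ψ (hT23 α) (hρ23pos α) (hT2 α) (hρ2pos α)
      (trace_ptraceSnd_mul _) (by rw [hρ2]; exact trace_ptraceSnd_mul _)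
  have hinstr : ∑ α, relEntropy (T23 α) (ψ (ptraceSnd (T23 α))) ≤
      relEntropy T (χ (ptraceSnd T)) :=
    sum_relEntropy_le φ hκ hT (posDef_kroneckerOneHom hT12) hT23
      (fun α => posDef_kroneckerOneHom (hT2 α)) hT23Y (fun α Y => by
        rw [hT23def, hψ, hχ, kroneckerOneHom_ptraceSnd_ptraceFst₃_conj]
        exact trace_ptraceFst₃_conj_mul _ _ _)
  have hklein := trace_sub_trace_le_relEntropy hT12 hρ12
  have hTX : (T * X).trace.re = (ptraceSnd T * matLog (ptraceSnd ρ)).trace.re -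
      ∑ α, ((ptraceSnd (T23 α) * matLog (ρ2 α)).trace.re -
        (T23 α * matLog (ρ23 α)).trace.re) := by
    rw [hXdef, mul_sub, trace_sub, Complex.sub_re, Finset.mul_sum, trace_sum, Complex.re_sum,
      trace_ptraceSnd_mul]
    congr 1
    refine Finset.sum_congr rfl fun α _ => ?_
    rw [← map_sub, ← hT23Y, mul_sub, trace_sub, Complex.sub_re, trace_ptraceSnd_mul]
  rw [trace_ptraceSnd, trace_ptraceSnd, hρtr, Complex.one_re] at hklein
  have hpartial_sum := Finset.sum_le_sum fun α (_ : α ∈ Finset.univ) => hpartial α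
  have hψlog : ∀ α, (T23 α * matLog (ψ (ptraceSnd (T23 α)))).trace.re =
      (ptraceSnd (T23 α) * matLog (ptraceSnd (T23 α))).trace.re := fun α => by
    rw [← map_matLog ψ (hT2 α).isHermitian, trace_ptraceSnd_mul]
  have hχlog : (T * matLog (χ (ptraceSnd T))).trace.re =
      (ptraceSnd T * matLog (ptraceSnd T)).trace.re := by
    rw [← map_matLog χ hT12.isHermitian, trace_ptraceSnd_mul]
  simp only [relEntropy, mul_sub, trace_sub, Complex.sub_re, Finset.sum_sub_distrib, hψlog, hχlog,
    hlogT] at hklein hpartial_sum hinstr hTX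
  linarith
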